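/- Let μ, μ' ∈ ℝ and λ ∈ ℝ. Suppose f : ℝ → ℂ is a twice continuously differentiable, square-integrable function, not identically zero, satisfying the Schrödinger-type eigenvalue equation −f''(z) + (μ² e^{−2z} + (μ')² e^{2z}) f(z) = λ f(z) for all z ∈ ℝ. Then λ ≥ 2|μμ'|. -/

import Mathlib

open MeasureTheory

/-- A nonnegative convex function on the line that is integrable vanishes identically. -/
theorem ConvexOn.eq_zero_of_integrable {g : ℝ → ℝ} (hconv : ConvexOn ℝ Set.univ g)
    (hnonneg : ∀ x, 0 ≤ g x) (hint : Integrable g volume) (x : ℝ) : g x = 0 := by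
  have hsum : Integrable (fun t : ℝ => (1 / 2 : ℝ) * (g (x - t) + g (x + t))) volume :=
    ((hint.comp_sub_left x).add (hint.comp_add_left x)).const_mul _
  have hmid : ∀ t : ℝ, g x ≤ (1 / 2 : ℝ) * (g (x - t) + g (x + t)) := by
    intro t
    have h := hconv.2 (Set.mem_univ (x - t)) (Set.mem_univ (x + t))
      (by norm_num : (0 : ℝ) ≤ 1 / 2) (by norm_num : (0 : ℝ) ≤ 1 / 2) (by norm_num)
    have hx : (1 / 2 : ℝ) • (x - t) + (1 / 2 : ℝ) • (x + t) = x := by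
      simp only [smul_eq_mul]; ring
    rw [hx] at h
    simp only [smul_eq_mul] at h
    linarith
  have hconst : Integrable (fun _ : ℝ => g x) volume :=
    hsum.mono' aestronglyMeasurable_const <| Filter.Eventually.of_forall fun t => by
      rw [Real.norm_of_nonneg (hnonneg x)]
      exact hmid t
  rcases integrable_const_iff.1 hconst with h | h
  · exact h
  · have := h.measure_univ_lt_top
    simp at this

/-- The squared norm of a solution of `f'' = q f` with `q ≥ 0` is convex. -/
theorem convexOn_norm_sq_of_deriv_deriv_eq_smul {f : ℝ → ℂ} {q : ℝ → ℝ}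
    (hf : ContDiff ℝ 2 f) (hq : ∀ z, 0 ≤ q z) (hode : ∀ z, deriv (deriv f) z = q z • f z) :
    ConvexOn ℝ Set.univ (fun z => ‖f z‖ ^ 2) := by
  have hd : ∀ z, HasDerivAt f (deriv f z) z := fun z =>
    (hf.differentiable (by norm_num) z).hasDerivAt
  have hd' : ∀ z, HasDerivAt (deriv f) (deriv (deriv f) z) z := fun z =>
    (hf.differentiable_deriv_two z).hasDerivAt
  have hg : ∀ z, HasDerivAt (fun z => ‖f z‖ ^ 2) (2 * inner ℝ (f z) (deriv f z)) z := fun z =>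
    (hd z).norm_sq
  have hg' : ∀ z, HasDerivAt (fun z => 2 * inner ℝ (f z) (deriv f z))
      (2 * (inner ℝ (f z) (deriv (deriv f) z) + inner ℝ (deriv f z) (deriv f z))) z := fun z =>
    ((hd z).inner ℝ (hd' z)).const_mul 2
  have hderiv : deriv (fun z => ‖f z‖ ^ 2) = fun z => 2 * inner ℝ (f z) (deriv f z) :=
    funext fun z => (hg z).deriv
  refine convexOn_univ_of_deriv2_nonneg (fun z => (hg z).differentiableAt) ?_ fun z => ?_
  · rw [hderiv]
    exact fun z => (hg' z).differentiableAt
  · rw [Function.iterate_succ_apply, Function.iterate_one, hderiv, (hg' z).deriv, hode,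
      real_inner_smul_right, real_inner_self_eq_norm_sq, real_inner_self_eq_norm_sq]
    have := hq z
    positivity

/-- The first eigenvalue of the Fourier-mode operator
`Δ_{μ,μ'} f = -f'' + (μ² e^{-2z} + (μ')² e^{2z}) f` on `L²(ℝ)` is at least `2|μμ'|`. -/
theorem eigenvalue_lower_bound
    (μ μ' lam : ℝ) (f : ℝ → ℂ)
    (hf : ContDiff ℝ 2 f)
    (hL2 : Integrable (fun z : ℝ => ‖f z‖ ^ 2) volume)
    (hne : f ≠ 0)
    (hode : ∀ z : ℝ,
      -(deriv (deriv f) z) +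
        ((μ ^ 2 * Real.exp (-2 * z) + μ' ^ 2 * Real.exp (2 * z) : ℝ) : ℂ) * f z
        = (lam : ℂ) * f z) :
    2 * |μ * μ'| ≤ lam := by
  by_contra! hlt
  have hpot : ∀ z : ℝ,
      0 ≤ μ ^ 2 * Real.exp (-2 * z) + μ' ^ 2 * Real.exp (2 * z) - lam := by
    intro z
    have h := two_mul_le_add_sq (|μ| * Real.exp (-z)) (|μ'| * Real.exp z)
    have h1 : Real.exp (-2 * z) = Real.exp (-z) ^ 2 := by
      rw [← Real.exp_nat_mul]; congr 1; push_cast; ring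
    have h2 : Real.exp (2 * z) = Real.exp z ^ 2 := by
      rw [← Real.exp_nat_mul]; norm_num
    have h3 : Real.exp (-z) * Real.exp z = 1 := by
      rw [← Real.exp_add]; simp
    have h4 : 2 * (|μ| * Real.exp (-z)) * (|μ'| * Real.exp z) = 2 * |μ * μ'| := by
      rw [abs_mul]
      linear_combination 2 * |μ| * |μ'| * h3
    rw [h4, mul_pow, mul_pow, sq_abs, sq_abs, ← h1, ← h2] at h
    linarith
  have hode' : ∀ z, deriv (deriv f) z =
      (μ ^ 2 * Real.exp (-2 * z) + μ' ^ 2 * Real.exp (2 * z) - lam) • f z := by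
    intro z
    rw [Complex.real_smul, Complex.ofReal_sub]
    linear_combination -hode z
  refine hne (funext fun z => ?_)
  have hz := (convexOn_norm_sq_of_deriv_deriv_eq_smul hf hpot hode').eq_zero_of_integrable
    (fun _ => sq_nonneg _) hL2 z
  simpa using hz
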